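/- For all integers n ≥ 0 and i ≥ 0, the following identity of formal power series in the variables x_1, x_2, … holds: (coefficient of t^i in (1−t)·h_n) = (coefficient of t^i in Σ_{m=0}^{n} Σ_{j≥0} Q_{m,j} · h_{n−m} · (t^{j+n−m} − t^{j+1})). Equivalently, as formal power series in t and z over the ring of formal power series in x_1,x_2,…, one has (Σ_{n,j≥0} Q_{n,j} t^j z^n) · (H(zt) − t·H(z)) = (1−t)·H(z), where H(z) = Σ_{n≥0} h_n z^n. -/

import Mathlib

/-!
STATEMENT 5: As formal power series in t and z over the ring of formal power series in
x_1, x_2, …, one has (Σ_{n,j≥0} Q_{n,j} t^j z^n) · (H(zt) − t·H(z)) = (1−t)·H(z),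
where H(z) = Σ_{n≥0} h_n z^n.

We work in `MvPowerSeries (Fin 2) R` with `R = MvPowerSeries ℕ+ ℚ`, where variable `0`
is `t` and variable `1` is `z`.  A series such as `H(zt) = Σ_n h_n t^n z^n` is specified
by its (t,z)-coefficients.
-/

open scoped Classical

/-- The one-line value `σ(i)` of a permutation of `[n] = {1,…,n}` (1-based), extended
to all of `ℕ` by the identity outside `[n]`. -/
def pv {n : ℕ} (σ : Equiv.Perm (Fin n)) (i : ℕ) : ℕ :=
  if h : 1 ≤ i ∧ i ≤ n then ((σ ⟨i - 1, by omega⟩ : Fin n) : ℕ) + 1 else i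

/-- The excedance set `Exc(σ) = {i ∈ [n-1] : σ(i) > i}`. -/
def ExcSet {n : ℕ} (σ : Equiv.Perm (Fin n)) : Finset ℕ :=
  (Finset.Icc 1 (n - 1)).filter fun i => i < pv σ i

/-- The excedance number `exc(σ) = |Exc(σ)|`. -/
def exc {n : ℕ} (σ : Equiv.Perm (Fin n)) : ℕ := (ExcSet σ).card

/-- The excedance-descent set `Exd(σ) ⊆ [n-1]`: `i ∈ Exd(σ)` iff
(σ(i) ≤ i and σ(i+1) > i+1), or (σ(i) > i and σ(i+1) > i+1 and σ(i) > σ(i+1)),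
or (σ(i) ≤ i and σ(i+1) ≤ i+1 and σ(i) > σ(i+1)). -/
def ExdSet {n : ℕ} (σ : Equiv.Perm (Fin n)) : Finset ℕ :=
  (Finset.Icc 1 (n - 1)).filter fun i =>
    (pv σ i ≤ i ∧ i + 1 < pv σ (i + 1)) ∨
    (i < pv σ i ∧ i + 1 < pv σ (i + 1) ∧ pv σ (i + 1) < pv σ i) ∨
    (pv σ i ≤ i ∧ pv σ (i + 1) ≤ i + 1 ∧ pv σ (i + 1) < pv σ i)

/-- The ring of formal power series in countably many variables x_1, x_2, … over ℚ. -/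
abbrev R : Type := MvPowerSeries ℕ+ ℚ

/-- The fundamental quasisymmetric function `F_{S,n}(x_1,x_2,…)`: its coefficient on the
monomial with exponent vector `d` is the number of sequences of positive integers
`i_1 ≥ ⋯ ≥ i_n` with `i_j > i_{j+1}` for all `j ∈ S` whose associated monomial
`x_{i_1}⋯x_{i_n}` is `x^d` (the sequence is recorded as `f : Fin n → ℕ+`, with `f j` the
`(j+1)`-st entry `i_{j+1}`). -/
noncomputable def Fqs (n : ℕ) (S : Finset ℕ) : R := fun d =>
  (Nat.card {f : Fin n → ℕ+ //
    (∀ j : Fin n, ∀ hj : j.val + 1 < n,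
      f ⟨j.val + 1, hj⟩ ≤ f j ∧ (j.val + 1 ∈ S → f ⟨j.val + 1, hj⟩ < f j)) ∧
    ∀ i : ℕ+, d i = (Finset.univ.filter fun j => f j = i).card} : ℚ)

/-- `Q_{n,j} = Σ F_{Exd(σ),n}` over permutations `σ ∈ S_n` with `exc(σ) = j`. -/
noncomputable def Qsym (n j : ℕ) : R :=
  ∑ σ ∈ Finset.univ.filter (fun σ : Equiv.Perm (Fin n) => exc σ = j), Fqs n (ExdSet σ)

/-- The complete homogeneous symmetric function `h_n`: every monomial of total degree
`n` has coefficient `1`. -/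
noncomputable def hSym (n : ℕ) : R := fun d => if (d.sum fun _ e => e) = n then 1 else 0

/-- The generating function `Σ_{n,j≥0} Q_{n,j} t^j z^n` (coefficient of `t^j z^n`
is `Q_{n,j}`); variable `0` is `t`, variable `1` is `z`. -/
noncomputable def genQ : MvPowerSeries (Fin 2) R := fun d => Qsym (d 1) (d 0)

/-- `H(zt) = Σ_{n≥0} h_n t^n z^n`. -/
noncomputable def Hzt : MvPowerSeries (Fin 2) R := fun d =>
  if d 0 = d 1 then hSym (d 1) else 0

/-- `H(z) = Σ_{n≥0} h_n z^n`. -/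
noncomputable def Hz : MvPowerSeries (Fin 2) R := fun d =>
  if d 0 = 0 then hSym (d 1) else 0

/-- The variable `t`. -/
noncomputable def T : MvPowerSeries (Fin 2) R := MvPowerSeries.X 0

section WeightedWords

open MvPowerSeries

lemma coeff_X_mul_eq_ite {ι A : Type*} [CommRing A] (b : ι) (φ : MvPowerSeries ι A)
    (d : ι →₀ ℕ) :
    coeff d (X b * φ) = if d b = 0 then 0 else coeff (d - Finsupp.single b 1) φ := by
  rw [X, coeff_monomial_mul]
  simp only [Finsupp.single_le_iff, one_mul]
  split_ifs <;> first | rfl | omega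

variable {ι A : Type*} [LinearOrder ι] [CommRing A]

/-- The multivariate power series with the coefficients `φ`, restricted to the monomials in the
variables from `T`. -/
noncomputable def restrictSeries (T : Finset ι) (φ : (ι →₀ ℕ) → A) : MvPowerSeries ι A :=
  fun d => if d.support ⊆ T then φ d else 0

lemma coeff_restrictSeries (T : Finset ι) (φ : (ι →₀ ℕ) → A) (d : ι →₀ ℕ) :
    coeff d (restrictSeries T φ) = if d.support ⊆ T then φ d else 0 := rfl

lemma support_sub_single_subset_iff {T : Finset ι} {b : ι} (hb : b ∈ T) (d : ι →₀ ℕ) :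
    (d - Finsupp.single b 1).support ⊆ T ↔ d.support ⊆ T := by
  constructor
  · intro h a ha
    by_cases hab : a = b
    · exact hab ▸ hb
    · apply h
      rw [Finsupp.mem_support_iff] at ha ⊢
      rwa [Finsupp.tsub_apply, Finsupp.single_eq_of_ne hab, Nat.sub_zero]
  · exact fun h => Finsupp.support_tsub.trans h

lemma X_mul_restrictSeries {T : Finset ι} {b : ι} (hb : b ∈ T) (φ : (ι →₀ ℕ) → A) :
    X b * restrictSeries T φ =
      restrictSeries T fun d => if d b = 0 then 0 else φ (d - Finsupp.single b 1) := by
  ext d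
  simp only [coeff_X_mul_eq_ite, coeff_restrictSeries, support_sub_single_subset_iff hb]
  split_ifs <;> rfl

lemma support_subset_insert_iff_of_eq_zero {s : Finset ι} {b : ι} {d : ι →₀ ℕ} (h : d b = 0) :
    d.support ⊆ insert b s ↔ d.support ⊆ s := by
  rw [Finset.subset_insert_iff_of_notMem]
  simpa using h

/-- The product over `b ∈ T` of `1 - r x_b` is inverse to the complete homogeneous series. -/
lemma prod_one_sub_mul_restrictSeries_pow (r : A) (T : Finset ι) :
    (∏ b ∈ T, (1 - C r * X b)) * restrictSeries T (fun d => r ^ d.degree) = 1 := by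
  induction T using Finset.induction_on with
  | empty =>
    ext d
    rw [Finset.prod_empty, one_mul, coeff_restrictSeries, coeff_one]
    by_cases hd : d = 0 <;> simp [hd]
  | insert b s hb ih =>
    have key : (1 - C r * X b) * restrictSeries (insert b s) (fun d => r ^ d.degree)
        = restrictSeries s (fun d => r ^ d.degree) := by
      rw [sub_mul, one_mul, mul_assoc, X_mul_restrictSeries (Finset.mem_insert_self b s)]
      ext d
      rw [map_sub, coeff_C_mul, coeff_restrictSeries, coeff_restrictSeries, coeff_restrictSeries]
      by_cases h0 : d b = 0
      · simp [h0, support_subset_insert_iff_of_eq_zero h0]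
      · have h1 : ¬ d.support ⊆ s := fun h => hb (h (by simpa using h0))
        have h2 : d.degree = (d - Finsupp.single b 1).degree + 1 := by
          conv_lhs => rw [← tsub_add_cancel_of_le
            (show Finsupp.single b 1 ≤ d by rw [Finsupp.single_le_iff]; omega)]
          simp
        simp only [h0, h1, if_false]
        split_ifs
        · rw [h2, pow_succ]; ring
        · ring
    rw [Finset.prod_insert hb, mul_comm (1 - _), mul_assoc, key, ih]

/-- The weight of the letter `a` in a block labelled `b`. -/
def rowWeight (t : A) (b a : ι) : A := if a < b then 1 else if b < a then t else 1 + t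

/-- The linear form collecting the weighted letters from `S` in a block labelled `b`. -/
noncomputable def rowForm (S : Finset ι) (t : A) (b : ι) : MvPowerSeries ι A :=
  ∑ a ∈ S, C (rowWeight t b a) * X a

/-- The product of linear forms for all blocks, where block `b` has length `d b`. -/
noncomputable def rowProd (S : Finset ι) (t : A) (d : ι →₀ ℕ) : MvPowerSeries ι A :=
  ∏ b ∈ S, rowForm S t b ^ d b

/-- The generating function of the diagonal coefficients of `rowProd`. -/
noncomputable def diagSeries (S T : Finset ι) (t : A) : MvPowerSeries ι A :=
  restrictSeries T fun d => coeff d (rowProd S t d)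

/-- The generating function of the coefficients of `rowProd` with one extra letter `b` and an
extra block of length one labelled `a`. -/
noncomputable def pathSeries (S T : Finset ι) (t : A) (b a : ι) : MvPowerSeries ι A :=
  restrictSeries T fun d => coeff (d + Finsupp.single b 1) (rowForm S t a * rowProd S t d)

lemma rowProd_of_ne_zero {S : Finset ι} {t : A} {d : ι →₀ ℕ} {b : ι} (hb : b ∈ S)
    (h : d b ≠ 0) :
    rowProd S t d = rowForm S t b * rowProd S t (d - Finsupp.single b 1) := by
  rw [rowProd, rowProd, ← Finset.mul_prod_erase S _ hb, ← Finset.mul_prod_erase S _ hb, ← mul_assoc,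
    ← pow_succ']
  congr 1
  · congr 1
    simp; omega
  · refine Finset.prod_congr rfl fun c hc => ?_
    rw [Finsupp.tsub_apply, Finsupp.single_eq_of_ne (Finset.ne_of_mem_erase hc), Nat.sub_zero]

lemma diagSeries_insert {S s : Finset ι} {t : A} {b : ι} (hbS : b ∈ S) (hbs : b ∉ s) :
    diagSeries S (insert b s) t =
      diagSeries S s t + X b * pathSeries S (insert b s) t b b := by
  rw [pathSeries, X_mul_restrictSeries (Finset.mem_insert_self b s)]
  ext d
  rw [map_add, diagSeries, diagSeries, coeff_restrictSeries, coeff_restrictSeries,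
    coeff_restrictSeries]
  by_cases h0 : d b = 0
  · simp [h0, support_subset_insert_iff_of_eq_zero h0]
  · have h1 : ¬ d.support ⊆ s := fun h => hbs (h (by simpa using h0))
    simp only [h0, h1, if_false, zero_add]
    rw [tsub_add_cancel_of_le (show Finsupp.single b 1 ≤ d by rw [Finsupp.single_le_iff]; omega),
      ← rowProd_of_ne_zero hbS h0]

lemma pathSeries_eq {S s : Finset ι} {t : A} {a b : ι} (hS : insert b s ⊆ S) (hbs : b ∉ s) :
    pathSeries S (insert b s) t b a = C (rowWeight t a b) * diagSeries S (insert b s) t +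
      ∑ c ∈ s, C (rowWeight t a c) * (X c * pathSeries S (insert b s) t b c) := by
  have hX : ∀ c ∈ s, X c * pathSeries S (insert b s) t b c = _ :=
    fun c hc => X_mul_restrictSeries (Finset.mem_insert_of_mem hc) _
  rw [Finset.sum_congr rfl fun c hc => by rw [hX c hc]]
  ext d
  rw [map_add, map_sum, coeff_C_mul, pathSeries, diagSeries, coeff_restrictSeries,
    coeff_restrictSeries]
  simp only [coeff_C_mul, coeff_restrictSeries]
  by_cases hd : d.support ⊆ insert b s
  · simp only [hd, if_true]
    rw [rowForm, Finset.sum_mul, map_sum, ← Finset.sum_subset hS, Finset.sum_insert hbs]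
    · simp only [mul_assoc, coeff_C_mul]
      congr 1
      · rw [coeff_X_mul_eq_ite]
        simp
      · refine Finset.sum_congr rfl fun c hc => ?_
        have hcb : c ≠ b := fun h => hbs (h ▸ hc)
        rw [coeff_X_mul_eq_ite, Finsupp.add_apply, Finsupp.single_eq_of_ne hcb, add_zero]
        split_ifs with h0
        · rfl
        · rw [← rowProd_of_ne_zero (hS (Finset.mem_insert_of_mem hc)) h0]
          congr 3
          rw [← tsub_add_eq_add_tsub]
          rw [Finsupp.single_le_iff]; omega
    · intro c _ hc
      have h1 : ((d + Finsupp.single b 1 : ι →₀ ℕ) : ι → ℕ) c = 0 := by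
        rw [Finset.mem_insert, not_or] at hc
        rw [Finsupp.add_apply, Finsupp.single_eq_of_ne hc.1, add_zero]
        by_contra h
        rcases Finset.mem_insert.1 (hd (Finsupp.mem_support_iff.2 h)) with h | h
        · exact hc.1 h
        · exact hc.2 h
      rw [mul_assoc, coeff_C_mul, coeff_X_mul_eq_ite, if_pos h1, mul_zero]
  · simp [hd]

/-- The special case needed here of MacMahon's master theorem, with the determinant in the form
`∏ (1 - x_b) - t ∑ κ_a`, together with an explicit left null vector `κ`. -/
lemma exists_diagSeries_mul_eq_one (S T : Finset ι) (t : A) (hT : T ⊆ S) :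
    ∃ κ : ι → MvPowerSeries ι A,
      (∀ c ∈ T, ∑ a ∈ T, κ a * (C (rowWeight t a c) * X c) =
        κ c - X c * (∏ b ∈ T, (1 - X b) - C t * ∑ a ∈ T, κ a)) ∧
      ∏ b ∈ T, (1 - C t * X b) = ∏ b ∈ T, (1 - X b) + (1 - C t) * ∑ a ∈ T, κ a ∧
      diagSeries S T t * (∏ b ∈ T, (1 - X b) - C t * ∑ a ∈ T, κ a) = 1 := by
  induction T using Finset.induction_on_max with
  | empty =>
    refine ⟨0, by simp, by simp, ?_⟩
    ext d
    rw [diagSeries]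
    simp only [Finset.prod_empty, Finset.sum_empty, mul_zero, sub_zero, mul_one]
    rw [coeff_restrictSeries, coeff_one]
    by_cases hd : d = 0 <;> simp [hd, rowProd]
  | insert b s hs ih =>
    have hbs : b ∉ s := fun h => lt_irrefl _ (hs b h)
    have hbS : b ∈ S := hT (Finset.mem_insert_self b s)
    obtain ⟨κ, h1, h2, h3⟩ := ih ((Finset.subset_insert b s).trans hT)
    have hne : ∀ a ∈ s, a ≠ b := fun a ha h => hbs (h ▸ ha)
    set E : MvPowerSeries ι A := ∏ b ∈ s, (1 - X b) with hE
    set M := ∑ a ∈ s, κ a with hM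
    have hwb : ∀ a ∈ s, rowWeight t a b = t := fun a ha => by
      simp [rowWeight, (hs a ha), (hs a ha).not_gt]
    have hwb' : ∀ a ∈ s, rowWeight t b a = 1 := fun a ha => by
      simp [rowWeight, (hs a ha)]
    have hwbb : rowWeight t b b = 1 + t := by simp [rowWeight]
    let κ' : ι → MvPowerSeries ι A := fun a => if a = b then X b * E else κ a * (1 - C t * X b)
    have hκb : κ' b = X b * E := by simp [κ']
    have hκ : ∀ a ∈ s, κ' a = κ a * (1 - C t * X b) := fun a ha => by simp [κ', hne a ha]
    have hsum : ∑ a ∈ insert b s, κ' a = X b * E + M * (1 - C t * X b) := by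
      rw [Finset.sum_insert hbs, hκb, Finset.sum_congr rfl hκ, ← Finset.sum_mul]
    refine ⟨κ', ?_, ?_, ?_⟩
    · intro c hc
      rw [hsum, Finset.sum_insert hbs, Finset.prod_insert hbs, hκb,
        Finset.sum_congr rfl fun a ha => by rw [hκ a ha]]
      rcases Finset.mem_insert.1 hc with rfl | hc
      · rw [hκb, hwbb, Finset.sum_congr rfl fun a ha => by rw [hwb a ha], ← Finset.sum_mul,
          ← Finset.sum_mul, map_add, map_one]
        ring
      · have h4 : ∑ a ∈ s, κ a * (1 - C t * X b) * (C (rowWeight t a c) * X c) =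
            (1 - C t * X b) * ∑ a ∈ s, κ a * (C (rowWeight t a c) * X c) := by
          rw [Finset.mul_sum]
          exact Finset.sum_congr rfl fun a _ => by ring
        rw [h4, h1 c hc, hκ c hc, hwb' c hc, map_one]
        ring
    · rw [hsum, Finset.prod_insert hbs, Finset.prod_insert hbs, h2]
      ring
    · rw [hsum, Finset.prod_insert hbs]
      set G := diagSeries S (insert b s) t
      set Z := pathSeries S (insert b s) t b with hZ
      have hG : G = diagSeries S s t + X b * Z b := diagSeries_insert hbS hbs
      have hZb : Z b = (1 + C t) * G + ∑ c ∈ s, X c * Z c := by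
        rw [hZ, pathSeries_eq hT hbs, hwbb, map_add, map_one]
        congr 1
        exact Finset.sum_congr rfl fun c hc => by rw [hwb' c hc, map_one, one_mul]
      have hZs : ∑ a ∈ s, κ a * Z a =
          C t * M * G + ∑ c ∈ s, (κ c - X c * (E - C t * M)) * Z c := by
        calc ∑ a ∈ s, κ a * Z a
            = ∑ a ∈ s, (κ a * (C t * G) +
                ∑ c ∈ s, κ a * (C (rowWeight t a c) * X c) * Z c) := by
              refine Finset.sum_congr rfl fun a ha => ?_
              conv_lhs => rw [hZ, pathSeries_eq hT hbs, hwb a ha, mul_add, Finset.mul_sum]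
              congr 1
              exact Finset.sum_congr rfl fun c _ => by ring
          _ = _ := by
              rw [Finset.sum_add_distrib, ← Finset.sum_mul, Finset.sum_comm]
              congr 1
              · ring
              · exact Finset.sum_congr rfl fun c hc => by rw [← Finset.sum_mul, h1 c hc]
      have hZeq : (E - C t * M) * ∑ c ∈ s, X c * Z c = C t * M * G := by
        have h5 : ∑ c ∈ s, (κ c - X c * (E - C t * M)) * Z c =
            ∑ c ∈ s, κ c * Z c - (E - C t * M) * ∑ c ∈ s, X c * Z c := by
          rw [Finset.mul_sum s (fun c => X c * Z c), ← Finset.sum_sub_distrib]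
          exact Finset.sum_congr rfl fun c _ => by ring
        rw [h5] at hZs
        linear_combination hZs
      linear_combination h3 + (E - C t * M) * hG + X b * (E - C t * M) * hZb + X b * hZeq

/-- The product of linear forms for all blocks, where block `b` has length `d b` and a special
linear form for its first position. -/
noncomputable def blockProd (S : Finset ι) (t : A) (d : ι →₀ ℕ) : MvPowerSeries ι A :=
  ∏ b ∈ S, if d b = 0 then 1 else
    (rowForm S t b - C t * X b) * rowForm S t b ^ (d b - 1)

lemma restrictSeries_blockProd (S : Finset ι) (t : A) :
    restrictSeries S (fun d => coeff d (blockProd S t d)) =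
      (∏ b ∈ S, (1 - C t * X b)) * diagSeries S S t := by
  set V : ι → ℕ → MvPowerSeries ι A := fun b m => if m = 0 then 1 else
    (rowForm S t b - C t * X b) * rowForm S t b ^ (m - 1) with hV
  suffices H : ∀ U ⊆ S, restrictSeries S
      (fun d => coeff d ((∏ b ∈ U, V b (d b)) * ∏ b ∈ S \ U, rowForm S t b ^ d b)) =
      (∏ b ∈ U, (1 - C t * X b)) * diagSeries S S t by
    have := H S subset_rfl
    simp only [Finset.sdiff_self, Finset.prod_empty, mul_one] at this
    exact this
  intro U
  induction U using Finset.induction_on with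
  | empty => intro _; simp [diagSeries, rowProd]
  | insert b U hb ih =>
    intro hU
    have hbS : b ∈ S := hU (Finset.mem_insert_self b U)
    have hbU : b ∈ S \ U := Finset.mem_sdiff.2 ⟨hbS, hb⟩
    rw [Finset.prod_insert hb, mul_assoc, ← ih ((Finset.subset_insert b U).trans hU), sub_mul,
      one_mul, mul_assoc, X_mul_restrictSeries hbS]
    ext d
    rw [map_sub, coeff_C_mul, coeff_restrictSeries, coeff_restrictSeries, coeff_restrictSeries]
    split_ifs with hd h0
    · rw [Finset.sdiff_insert, Finset.prod_insert hb, ← Finset.mul_prod_erase _ _ hbU, h0]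
      simp [hV]
    · have h1 : ∀ c, c ≠ b → (d - Finsupp.single b 1 : ι →₀ ℕ) c = d c := fun c hc => by
        rw [Finsupp.tsub_apply, Finsupp.single_eq_of_ne hc, Nat.sub_zero]
      have h2 : (d - Finsupp.single b 1 : ι →₀ ℕ) b = d b - 1 := by simp
      have hU' : ∏ c ∈ U, V c ((d - Finsupp.single b 1 : ι →₀ ℕ) c) = ∏ c ∈ U, V c (d c) :=
        Finset.prod_congr rfl fun c hc => by rw [h1 c fun h => hb (h ▸ hc)]
      have hS' : ∏ c ∈ (S \ U).erase b, rowForm S t c ^ (d - Finsupp.single b 1 : ι →₀ ℕ) c =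
          ∏ c ∈ (S \ U).erase b, rowForm S t c ^ d c :=
        Finset.prod_congr rfl fun c hc => by rw [h1 c (Finset.ne_of_mem_erase hc)]
      have hX : ∀ p : MvPowerSeries ι A,
          coeff (d - Finsupp.single b 1) p = coeff d (X b * p) := fun p => by
        rw [coeff_X_mul_eq_ite, if_neg h0]
      rw [hX, ← coeff_C_mul, ← map_sub]
      congr 1
      rw [Finset.sdiff_insert, Finset.prod_insert hb, ← Finset.mul_prod_erase _ _ hbU,
        ← Finset.mul_prod_erase _ _ hbU, h2, hU', hS']
      have h3 : V b (d b) = (rowForm S t b - C t * X b) * rowForm S t b ^ (d b - 1) := if_neg h0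
      rw [h3]
      obtain ⟨m, hm⟩ := Nat.exists_eq_succ_of_ne_zero h0
      rw [hm, Nat.succ_sub_one, pow_succ]
      ring
    · simp

/-- The generating function identity for weighted words on a finite alphabet. -/
lemma restrictSeries_blockProd_mul (S : Finset ι) (t : A) :
    restrictSeries S (fun d => coeff d (blockProd S t d)) *
      (restrictSeries S (fun d => t ^ d.degree) - C t * restrictSeries S (fun _ => 1)) =
    (1 - C t) * restrictSeries S (fun _ => 1) := by
  obtain ⟨κ, -, h1, h2⟩ := exists_diagSeries_mul_eq_one S S t subset_rfl
  have h3 := prod_one_sub_mul_restrictSeries_pow t S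
  have h4 := prod_one_sub_mul_restrictSeries_pow (1 : A) S
  simp only [map_one, one_mul, one_pow] at h4
  rw [restrictSeries_blockProd]
  set E : MvPowerSeries ι A := ∏ b ∈ S, (1 - X b)
  set F : MvPowerSeries ι A := ∏ b ∈ S, (1 - C t * X b)
  set G := diagSeries S S t
  set H := restrictSeries S (fun _ : ι →₀ ℕ => (1 : A))
  set Ht := restrictSeries S (fun d : ι →₀ ℕ => t ^ d.degree)
  set M := ∑ a ∈ S, κ a
  have h5 : G * (E - C t * F) = 1 - C t := by
    linear_combination (1 - C t) * h2 - C t * G * h1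
  have h6 : E * (F * G * (Ht - C t * H)) = 1 - C t := by
    linear_combination h5 + E * G * h3 - C t * F * G * h4
  linear_combination H * h6 - (F * G * (Ht - C t * H)) * h4

end WeightedWords

section Standardization

variable {ι : Type*} {n : ℕ}

/-- The content of a word: the number of occurrences of each letter. -/
noncomputable def content (f : Fin n → ι) : ι →₀ ℕ := ∑ j, Finsupp.single (f j) 1

lemma degree_content (f : Fin n → ι) : (content f).degree = n := by
  simp [content]

lemma content_comp_perm (f : Fin n → ι) (σ : Equiv.Perm (Fin n)) :
    content (fun j => f (σ j)) = content f :=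
  Equiv.sum_comp σ fun j => Finsupp.single (f j) 1

/-- The barred word of a permutation. -/
def barredWord (σ : Equiv.Perm (Fin n)) (f : Fin n → ι) (j : Fin n) : ι × Bool :=
  (f (σ.symm j), decide (j ≤ σ.symm j))

lemma content_barredWord (σ : Equiv.Perm (Fin n)) (f : Fin n → ι) :
    content (fun j => (barredWord σ f j).1) = content f :=
  content_comp_perm f σ.symm

variable [LinearOrder ι]

lemma content_apply (f : Fin n → ι) (a : ι) :
    content f a = (Finset.univ.filter fun j => f j = a).card := by
  rw [content, Finsupp.finsetSum_apply, Finset.card_filter]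
  simp only [Finsupp.single_apply]

lemma content_eq_toFinsupp (f : Fin n → ι) :
    content f = Multiset.toFinsupp (List.ofFn f : Multiset ι) := by
  rw [← Fin.univ_val_map, ← Multiset.sum_map_singleton (Multiset.map f _), Multiset.map_map,
    map_multiset_sum, Multiset.map_map, content, Finset.sum_eq_multiset_sum]
  congr 2
  ext j
  simp

/-- A weakly decreasing word is determined by its content. -/
lemma eq_of_antitone_of_content_eq {f g : Fin n → ι} (hf : Antitone f) (hg : Antitone g)
    (h : content f = content g) : f = g := by
  rw [content_eq_toFinsupp, content_eq_toFinsupp, EmbeddingLike.apply_eq_iff_eq,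
    Multiset.coe_eq_coe] at h
  exact List.ofFn_injective
    (h.eq_of_pairwise' hf.sortedGE_ofFn.pairwise hg.sortedGE_ofFn.pairwise)

/-- Every finitely supported function is the content of a weakly decreasing word. -/
lemma exists_antitone_content_eq (d : ι →₀ ℕ) (hd : d.degree = n) :
    ∃ f : Fin n → ι, Antitone f ∧ content f = d := by
  set l := (Finsupp.toMultiset d).sort (· ≥ ·) with hl
  have hlen : l.length = n := by
    rw [hl, Multiset.length_sort, Finsupp.card_toMultiset, ← hd, Finsupp.degree, Finsupp.sum]
    rfl
  subst hlen
  have hs : l.SortedGE := by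
    rw [hl]
    exact (Multiset.pairwise_sort _ _).sortedGE
  refine ⟨l.get, hs.antitone_get, ?_⟩
  rw [content_eq_toFinsupp, List.ofFn_get, hl, Multiset.sort_eq, Finsupp.toMultiset_toFinsupp]

/-- There is no excedance-descent of `σ` between positions carrying equal letters of `f`. -/
def Compatible (σ : Equiv.Perm (Fin n)) (f : Fin n → ι) : Prop :=
  ∀ i j : Fin n, i.val + 1 = j.val → f j = f i →
    (j < σ j → i < σ i) ∧ ((i < σ i ↔ j < σ j) → σ i < σ j)

/-- The condition on the letter `p` at position `j`, where `p.2 = false` encodes a bar: letters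
larger than `f j` are barred, smaller ones are not, and `f j` is not barred at the first position
of its block. -/
def LetterAllowed (f : Fin n → ι) (j : Fin n) (p : ι × Bool) : Prop :=
  (f j < p.1 → p.2 = false) ∧ (p.1 < f j → p.2 = true) ∧
    (p.1 = f j → (∀ i < j, f i ≠ f j) → p.2 = true)

/-- Letters are sorted decreasingly, with barred letters before unbarred ones. -/
def lexWord (u : Fin n → ι × Bool) (j : Fin n) : ιᵒᵈ ×ₗ Bool :=
  toLex (OrderDual.toDual (u j).1, (u j).2)

lemma letterAllowed_barredWord (σ : Equiv.Perm (Fin n)) {f : Fin n → ι} (hf : Antitone f)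
    (j : Fin n) : LetterAllowed f j (barredWord σ f j) := by
  refine ⟨fun h => ?_, fun h => ?_, fun h hfirst => ?_⟩
  · simp only [barredWord, decide_eq_false_iff_not] at h ⊢
    exact fun h' => (hf h').not_gt h
  · simp only [barredWord, decide_eq_true_eq] at h ⊢
    by_contra h'
    exact (hf (not_le.1 h').le).not_gt h
  · simp only [barredWord, decide_eq_true_eq] at h ⊢
    by_contra h'
    exact hfirst _ (not_le.1 h') h

lemma strictMono_of_lt_of_succ_eq {α : Type*} [Preorder α] {g : Fin n → α}
    (h : ∀ i j : Fin n, i.val + 1 = j.val → g i < g j) : StrictMono g := by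
  cases n with
  | zero => exact fun i => i.elim0
  | succ m => exact Fin.strictMono_iff_lt_succ.2 fun i => h _ _ (by simp)

lemma Compatible.eq_sort {σ : Equiv.Perm (Fin n)} {f : Fin n → ι} (hf : Antitone f)
    (h : Compatible σ f) : σ = Tuple.sort (lexWord (barredWord σ f)) := by
  have hmono : StrictMono fun i =>
      (toLex (lexWord (barredWord σ f) (σ i), σ i) : (ιᵒᵈ ×ₗ Bool) ×ₗ Fin n) := by
    refine strictMono_of_lt_of_succ_eq fun i j hij => ?_
    have hle : f j ≤ f i := hf (Fin.le_def.2 (by omega))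
    simp only [Prod.Lex.toLex_lt_toLex, lexWord, barredWord, Equiv.symm_apply_apply]
    rcases hle.lt_or_eq with hlt | heq
    · exact Or.inl (Or.inl hlt)
    · obtain ⟨h1, h2⟩ := h i j hij heq
      rw [heq]
      by_cases hi : i < σ i <;> by_cases hj : j < σ j
      · exact Or.inr ⟨by simp [hi.not_ge, hj.not_ge], h2 (by simp [hi, hj])⟩
      · refine Or.inl (Or.inr ⟨rfl, ?_⟩)
        simp [hi.not_ge, not_lt.1 hj]
      · exact absurd (h1 hj) hi
      · exact Or.inr ⟨by simp [not_lt.1 hi, not_lt.1 hj], h2 (by simp [hi, hj])⟩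
  rw [Tuple.eq_sort_iff]
  refine ⟨fun i j hij => ?_, fun i j hij heq => ?_⟩
  · rcases hij.lt_or_eq with hlt | rfl
    · rcases Prod.Lex.toLex_lt_toLex.1 (hmono hlt) with h | h
      · exact h.le
      · exact h.1.le
    · exact le_rfl
  · rcases Prod.Lex.toLex_lt_toLex.1 (hmono hij) with h | h
    · exact absurd heq h.ne
    · exact h.2

section Inverse

variable {f : Fin n → ι} {u : Fin n → ι × Bool}

lemma fst_sort_lexWord (hf : Antitone f) (hu : content (fun j => (u j).1) = content f)
    (i : Fin n) : (u (Tuple.sort (lexWord u) i)).1 = f i := by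
  have hm : Antitone fun i => (u (Tuple.sort (lexWord u) i)).1 := fun i j hij => by
    have := Tuple.monotone_sort (lexWord u) hij
    rcases Prod.Lex.toLex_le_toLex.1 this with h | h
    · exact (show (u (Tuple.sort (lexWord u) j)).1 < (u (Tuple.sort (lexWord u) i)).1 from h).le
    · exact (OrderDual.toDual.injective h.1).ge
  exact congrFun (eq_of_antitone_of_content_eq hm hf
    ((content_comp_perm (fun j => (u j).1) (Tuple.sort (lexWord u))).trans hu)) i

lemma snd_sort_lexWord_le (hf : Antitone f) (hu : content (fun j => (u j).1) = content f)
    {i j : Fin n} (hij : i < j) (heq : f j = f i) :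
    (u (Tuple.sort (lexWord u) i)).2 ≤ (u (Tuple.sort (lexWord u) j)).2 ∧
    ((u (Tuple.sort (lexWord u) i)).2 = (u (Tuple.sort (lexWord u) j)).2 →
      Tuple.sort (lexWord u) i < Tuple.sort (lexWord u) j) := by
  have h1 : (u (Tuple.sort (lexWord u) i)).1 = (u (Tuple.sort (lexWord u) j)).1 := by
    rw [fst_sort_lexWord hf hu, fst_sort_lexWord hf hu, heq]
  constructor
  · rcases Prod.Lex.toLex_le_toLex.1 (Tuple.monotone_sort (lexWord u) hij.le) with h | h
    · exact absurd (congrArg OrderDual.toDual h1) h.ne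
    · exact h.2
  · intro h2
    refine (Tuple.eq_sort_iff.1 rfl).2 i j hij ?_
    simp only [lexWord, h1, h2]

lemma lt_sort_of_snd_eq_false (hf : Antitone f) (hu : content (fun j => (u j).1) = content f)
    (hall : ∀ j, LetterAllowed f j (u j)) (i : Fin n)
    (hi : (u (Tuple.sort (lexWord u) i)).2 = false) : i < Tuple.sort (lexWord u) i := by
  induction i using WellFoundedLT.induction with
  | _ i ih =>
    obtain ⟨-, h2, h3⟩ := hall (Tuple.sort (lexWord u) i)
    rw [fst_sort_lexWord hf hu, hi] at h2 h3
    have hle : f (Tuple.sort (lexWord u) i) ≤ f i := not_lt.1 fun h => absurd (h2 h) (by simp)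
    rcases hle.lt_or_eq with hlt | heq
    · exact not_le.1 fun h => (hf h).not_gt hlt
    · have h4 : ∃ k < Tuple.sort (lexWord u) i, f k = f i := by
        by_contra! h
        exact absurd (h3 heq.symm fun k hk => heq ▸ h k hk) (by simp)
      by_contra hlt
      obtain ⟨k, hk, hki⟩ := h4
      have hk_lt : k < i := hk.trans_le (not_lt.1 hlt)
      obtain ⟨l, hl⟩ : ∃ l : Fin n, l.val + 1 = i.val :=
        ⟨⟨i.val - 1, by omega⟩, by have := Fin.lt_def.1 hk_lt; simp only; omega⟩
      have hli : l < i := Fin.lt_def.2 (by omega)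
      have hfl : f i = f l := le_antisymm (hf hli.le)
        (hki ▸ hf (Fin.le_def.2 (by have := Fin.lt_def.1 hk_lt; omega)))
      obtain ⟨h5, h6⟩ := snd_sort_lexWord_le hf hu hli hfl
      rw [hi] at h5 h6
      have h7 : (u (Tuple.sort (lexWord u) l)).2 = false := le_antisymm h5 (Bool.false_le _)
      have h8 := Fin.lt_def.1 (ih l hli h7)
      have h9 := Fin.lt_def.1 (h6 h7)
      exact hlt (Fin.lt_def.2 (by omega))

lemma sort_le_of_snd_eq_true (hf : Antitone f) (hu : content (fun j => (u j).1) = content f)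
    (hall : ∀ j, LetterAllowed f j (u j)) (i : Fin n)
    (hi : (u (Tuple.sort (lexWord u) i)).2 = true) : Tuple.sort (lexWord u) i ≤ i := by
  induction i using WellFoundedGT.induction with
  | _ i ih =>
    obtain ⟨h1, -, -⟩ := hall (Tuple.sort (lexWord u) i)
    rw [fst_sort_lexWord hf hu, hi] at h1
    have hle : f i ≤ f (Tuple.sort (lexWord u) i) := not_lt.1 fun h => absurd (h1 h) (by simp)
    by_contra hlt
    rw [not_le] at hlt
    have heq : f (Tuple.sort (lexWord u) i) = f i := le_antisymm (hf hlt.le) hle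
    obtain ⟨l, hl⟩ : ∃ l : Fin n, i.val + 1 = l.val :=
      ⟨⟨i.val + 1, by have := Fin.lt_def.1 hlt; omega⟩, rfl⟩
    have hil : i < l := Fin.lt_def.2 (by omega)
    have hfl : f l = f i := le_antisymm (hf hil.le)
      (heq ▸ hf (Fin.le_def.2 (by have := Fin.lt_def.1 hlt; omega)))
    obtain ⟨h5, h6⟩ := snd_sort_lexWord_le hf hu hil hfl
    rw [hi] at h5 h6
    have h7 : (u (Tuple.sort (lexWord u) l)).2 = true := le_antisymm (Bool.le_true _) h5
    have h8 := Fin.le_def.1 (ih l hil h7)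
    have h9 := Fin.lt_def.1 (h6 h7.symm)
    have h10 := Fin.lt_def.1 hlt
    omega

lemma snd_sort_eq_true_iff (hf : Antitone f) (hu : content (fun j => (u j).1) = content f)
    (hall : ∀ j, LetterAllowed f j (u j)) (i : Fin n) :
    (u (Tuple.sort (lexWord u) i)).2 = true ↔ Tuple.sort (lexWord u) i ≤ i := by
  refine ⟨sort_le_of_snd_eq_true hf hu hall i, fun h => ?_⟩
  by_contra h'
  exact (lt_sort_of_snd_eq_false hf hu hall i (by simpa using h')).not_ge h

lemma compatible_sort (hf : Antitone f) (hu : content (fun j => (u j).1) = content f)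
    (hall : ∀ j, LetterAllowed f j (u j)) : Compatible (Tuple.sort (lexWord u)) f := by
  intro i j hij heq
  obtain ⟨h1, h2⟩ := snd_sort_lexWord_le hf hu (Fin.lt_def.2 (by omega) : i < j) heq
  have hi := snd_sort_eq_true_iff hf hu hall i
  have hj := snd_sort_eq_true_iff hf hu hall j
  refine ⟨fun h => ?_, fun h => h2 ?_⟩
  · rw [← not_le, ← hi]
    intro h3
    rw [h3] at h1
    exact h.not_ge (hj.1 (le_antisymm (Bool.le_true _) h1))
  · rw [Bool.eq_iff_iff, hi, hj, ← not_lt, ← not_lt, h]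

lemma barredWord_sort (hf : Antitone f) (hu : content (fun j => (u j).1) = content f)
    (hall : ∀ j, LetterAllowed f j (u j)) : barredWord (Tuple.sort (lexWord u)) f = u := by
  funext j
  obtain ⟨i, rfl⟩ := (Tuple.sort (lexWord u)).surjective j
  refine Prod.ext ?_ ?_
  · simp only [barredWord, Equiv.symm_apply_apply, fst_sort_lexWord hf hu]
  · rw [Bool.eq_iff_iff, snd_sort_eq_true_iff hf hu hall]
    simp only [barredWord, Equiv.symm_apply_apply, decide_eq_true_eq]

end Inverse

/-- The weight `t` for a barred letter. -/
def barWeight {A : Type*} [One A] (t : A) (b : Bool) : A := if b then 1 else t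

open Classical in
/-- Compatible permutations, weighted by excedances, correspond to allowed barred words. -/
lemma sum_compatible_eq_sum_words {A : Type*} [CommRing A] (t : A) {f : Fin n → ι}
    (hf : Antitone f) {S : Finset ι} (hS : ∀ j, f j ∈ S) :
    ∑ σ : Equiv.Perm (Fin n) with Compatible σ f,
      t ^ (Finset.univ.filter fun i => i < σ i).card =
    ∑ u ∈ Fintype.piFinset fun _ : Fin n => S ×ˢ (Finset.univ : Finset Bool) with
      content (fun j => (u j).1) = content f ∧ ∀ j, LetterAllowed f j (u j),
      ∏ j, barWeight t (u j).2 := by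
  refine Finset.sum_bij' (fun σ _ => barredWord σ f) (fun u _ => Tuple.sort (lexWord u))
    ?_ ?_ ?_ ?_ ?_
  · intro σ _
    simp only [Finset.mem_filter, Fintype.mem_piFinset, Finset.mem_product, Finset.mem_univ,
      and_true]
    exact ⟨fun j => hS _, content_barredWord σ f, letterAllowed_barredWord σ hf⟩
  · intro u hu
    obtain ⟨-, h1, h2⟩ := Finset.mem_filter.1 hu
    simpa using compatible_sort hf h1 h2
  · intro σ hσ
    exact (Compatible.eq_sort hf (Finset.mem_filter.1 hσ).2).symm
  · intro u hu
    obtain ⟨-, h1, h2⟩ := Finset.mem_filter.1 hu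
    exact barredWord_sort hf h1 h2
  · intro σ _
    rw [← Equiv.prod_comp σ, ← Finset.prod_const, Finset.prod_filter]
    refine Finset.prod_congr rfl fun i _ => ?_
    simp only [barWeight, barredWord, Equiv.symm_apply_apply, decide_eq_true_eq, ← not_lt, ite_not]

open MvPowerSeries

open Classical in
/-- The linear form for the position `j`, which is special at the first position of a block. -/
noncomputable def positionForm {A : Type*} [CommRing A] (S : Finset ι) (t : A) (f : Fin n → ι)
    (j : Fin n) : MvPowerSeries ι A :=
  if ∀ i < j, f i ≠ f j then rowForm S t (f j) - C t * X (f j) else rowForm S t (f j)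

open Classical in
lemma sum_monomial_letterAllowed {A : Type*} [CommRing A] (t : A) (f : Fin n → ι)
    {S : Finset ι} (hS : ∀ j, f j ∈ S) (j : Fin n) :
    ∑ p ∈ S ×ˢ (Finset.univ : Finset Bool), monomial (Finsupp.single p.1 1)
      (if LetterAllowed f j p then barWeight t p.2 else 0) = positionForm S t f j := by
  have h : positionForm S t f j = ∑ a ∈ S, C (rowWeight t (f j) a -
      if a = f j then (if ∀ i < j, f i ≠ f j then t else 0) else 0) * X a := by
    have hsum : ∀ e : A, ∑ a ∈ S, C (if a = f j then e else 0) * X a = C e * X (f j) :=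
      fun e => by
        rw [Finset.sum_eq_single_of_mem (f j) (hS j) fun a _ ha => by rw [if_neg ha, map_zero,
          zero_mul], if_pos rfl]
    simp only [map_sub, sub_mul, Finset.sum_sub_distrib, hsum]
    rw [positionForm, rowForm]
    split_ifs
    · rfl
    · rw [map_zero, zero_mul, sub_zero]
  rw [h, Finset.sum_product]
  refine Finset.sum_congr rfl fun a _ => ?_
  have hC : ∀ r : A, C r * X a = monomial (Finsupp.single a 1) r := fun r => by
    rw [X, ← monomial_zero_eq_C_apply, monomial_mul_monomial, zero_add, mul_one]
  rw [Fintype.sum_bool, hC, ← map_add]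
  congr 1
  rcases lt_trichotomy a (f j) with h1 | h1 | h1
  · simp [LetterAllowed, barWeight, rowWeight, h1, h1.not_gt, h1.ne]
  · subst h1
    have h2 : LetterAllowed f j (f j, true) :=
      ⟨fun h => absurd h (lt_irrefl _), fun _ => rfl, fun _ _ => rfl⟩
    have h3 : LetterAllowed f j (f j, false) ↔ ¬ ∀ i < j, f i ≠ f j :=
      ⟨fun h hP => absurd (h.2.2 rfl hP) (by simp),
        fun hP => ⟨fun _ => rfl, fun h => absurd h (lt_irrefl _), fun _ h => absurd h hP⟩⟩
    by_cases hP : ∀ i < j, f i ≠ f j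
    · rw [if_pos h2, if_neg (fun h => h3.1 h hP), if_pos rfl, if_pos hP]
      simp [barWeight, rowWeight]
    · rw [if_pos h2, if_pos (h3.2 hP), if_pos rfl, if_neg hP]
      simp [barWeight, rowWeight]
  · simp [LetterAllowed, barWeight, rowWeight, h1, h1.not_gt, h1.ne']

open Classical in
lemma sum_compatible_eq_coeff_prod {A : Type*} [CommRing A] (t : A) {f : Fin n → ι}
    (hf : Antitone f) {S : Finset ι} (hS : ∀ j, f j ∈ S) :
    ∑ σ : Equiv.Perm (Fin n) with Compatible σ f,
      t ^ (Finset.univ.filter fun i => i < σ i).card =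
    coeff (content f) (∏ j, positionForm S t f j) := by
  rw [sum_compatible_eq_sum_words t hf hS,
    ← Finset.prod_congr rfl fun j _ => sum_monomial_letterAllowed t f hS j,
    Finset.prod_univ_sum, map_sum, Finset.sum_filter]
  refine Finset.sum_congr rfl fun u _ => ?_
  rw [prod_monomial, coeff_monomial, Finset.prod_ite_zero, ite_and]
  simp only [content, Finset.mem_univ, true_imp_iff, eq_comm]

lemma prod_positionForm {A : Type*} [CommRing A] (t : A) (f : Fin n → ι)
    {S : Finset ι} (hS : ∀ j, f j ∈ S) :
    ∏ j, positionForm S t f j = blockProd S t (content f) := by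
  rw [blockProd, ← Finset.prod_fiberwise_of_maps_to (g := f) (fun j _ => hS j)]
  refine Finset.prod_congr rfl fun b _ => ?_
  rw [content_apply]
  set P := Finset.univ.filter fun j => f j = b with hP
  split_ifs with h0
  · rw [Finset.card_eq_zero.1 h0, Finset.prod_empty]
  · have hne : P.Nonempty := Finset.card_ne_zero.1 h0
    have hmin := P.min'_mem hne
    have hfm : f (P.min' hne) = b := (Finset.mem_filter.1 hmin).2
    rw [← Finset.mul_prod_erase P _ hmin, ← Finset.card_erase_of_mem hmin, ← Finset.prod_const]
    congr 1
    · rw [positionForm, if_pos, hfm]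
      intro i hi h
      exact (P.min'_le i (Finset.mem_filter.2 ⟨Finset.mem_univ i, h.trans hfm⟩)).not_gt hi
    · refine Finset.prod_congr rfl fun j hj => ?_
      have hfj : f j = b := (Finset.mem_filter.1 (Finset.mem_of_mem_erase hj)).2
      rw [positionForm, if_neg, hfj]
      intro h
      exact h _ (P.min'_lt_of_mem_erase_min' hne hj) (hfm.trans hfj.symm)

open Classical in
/-- The excedance polynomial of the permutations compatible with a weakly decreasing word. -/
lemma sum_compatible_eq_coeff_blockProd {A : Type*} [CommRing A] (t : A) {f : Fin n → ι}
    (hf : Antitone f) {S : Finset ι} (hS : ∀ j, f j ∈ S) :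
    ∑ σ : Equiv.Perm (Fin n) with Compatible σ f,
      t ^ (Finset.univ.filter fun i => i < σ i).card =
    coeff (content f) (blockProd S t (content f)) := by
  rw [sum_compatible_eq_coeff_prod t hf hS, prod_positionForm t f hS]

end Standardization

section Permutations

open MvPowerSeries

lemma pv_succ {n : ℕ} (σ : Equiv.Perm (Fin n)) (i : Fin n) : pv σ (i.val + 1) = (σ i).val + 1 := by
  rw [pv, dif_pos ⟨by omega, by omega⟩]
  rfl

lemma exc_eq_card {n : ℕ} (σ : Equiv.Perm (Fin n)) :
    exc σ = (Finset.univ.filter fun i => i < σ i).card := by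
  have h : ExcSet σ =
      (Finset.univ.filter fun i : Fin n => i < σ i).image fun i => i.val + 1 := by
    ext k
    simp only [ExcSet, Finset.mem_filter, Finset.mem_Icc, Finset.mem_image, Finset.mem_univ,
      true_and]
    constructor
    · rintro ⟨⟨h1, h2⟩, h3⟩
      obtain ⟨i, rfl⟩ : ∃ i : Fin n, i.val + 1 = k :=
        ⟨⟨k - 1, by omega⟩, by simp only; omega⟩
      rw [pv_succ] at h3
      exact ⟨i, Fin.lt_def.2 (by omega), rfl⟩
    · rintro ⟨i, hi, rfl⟩
      rw [pv_succ]
      have h1 := Fin.lt_def.1 hi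
      have h2 := (σ i).isLt
      omega
  rw [exc, h, Finset.card_image_of_injective]
  intro i j hij
  exact Fin.ext (by simpa using hij)

lemma mem_ExdSet_iff {n : ℕ} (σ : Equiv.Perm (Fin n)) {i j : Fin n} (hij : i.val + 1 = j.val) :
    i.val + 1 ∈ ExdSet σ ↔ (σ i ≤ i ∧ j < σ j) ∨ (i < σ i ∧ j < σ j ∧ σ j < σ i) ∨
      (σ i ≤ i ∧ σ j ≤ j ∧ σ j < σ i) := by
  have hj := j.isLt
  rw [ExdSet, Finset.mem_filter, pv_succ σ i, hij, pv_succ σ j, Finset.mem_Icc]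
  simp only [Fin.lt_def, Fin.le_def]
  omega

lemma compatible_iff {n : ℕ} (σ : Equiv.Perm (Fin n)) {f : Fin n → ℕ+} (hf : Antitone f) :
    Compatible σ f ↔ ∀ j : Fin n, ∀ hj : j.val + 1 < n,
      f ⟨j.val + 1, hj⟩ ≤ f j ∧ (j.val + 1 ∈ ExdSet σ → f ⟨j.val + 1, hj⟩ < f j) := by
  have key : ∀ i j : Fin n, i.val + 1 = j.val →
      (((j < σ j → i < σ i) ∧ ((i < σ i ↔ j < σ j) → σ i < σ j)) ↔ i.val + 1 ∉ ExdSet σ) := by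
    intro i j hij
    have hne : σ i ≠ σ j := fun h => by
      have := σ.injective h
      subst this
      omega
    rw [mem_ExdSet_iff σ hij]
    simp only [Fin.lt_def, Fin.le_def, ne_eq, Fin.ext_iff] at hne ⊢
    omega
  constructor
  · intro h j hj
    have hle : f ⟨j.val + 1, hj⟩ ≤ f j := hf (Fin.le_def.2 (by simp))
    refine ⟨hle, fun hmem => hle.lt_of_ne fun heq => ?_⟩
    exact (key j ⟨j.val + 1, hj⟩ rfl).1 (h j _ rfl heq) hmem
  · intro h i j hij heq
    rw [key i j hij]
    intro hmem
    have hj : (⟨i.val + 1, hij ▸ j.isLt⟩ : Fin n) = j := Fin.ext hij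
    have hlt := (h i (hij ▸ j.isLt)).2 hmem
    rw [hj] at hlt
    exact hlt.ne heq

lemma antitone_of_apply_succ_le {n : ℕ} {f : Fin n → ℕ+}
    (h : ∀ j : Fin n, ∀ hj : j.val + 1 < n, f ⟨j.val + 1, hj⟩ ≤ f j) : Antitone f := by
  cases n with
  | zero => exact fun i => i.elim0
  | succ m => exact Fin.antitone_iff_succ_le.2 fun i => h i.castSucc (by simp)

lemma coeff_Fqs_of_degree_ne {n : ℕ} (S : Finset ℕ) {d : ℕ+ →₀ ℕ} (hd : d.degree ≠ n) :
    coeff d (Fqs n S) = 0 := by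
  have : IsEmpty {f : Fin n → ℕ+ //
      (∀ j : Fin n, ∀ hj : j.val + 1 < n,
        f ⟨j.val + 1, hj⟩ ≤ f j ∧ (j.val + 1 ∈ S → f ⟨j.val + 1, hj⟩ < f j)) ∧
      ∀ i : ℕ+, d i = (Finset.univ.filter fun j => f j = i).card} := by
    refine ⟨fun ⟨f, _, h⟩ => hd ?_⟩
    rw [← degree_content f]
    congr 1
    ext i
    rw [h i, content_apply]
  rw [coeff_apply, Fqs, Nat.card_eq_zero.2 (Or.inl this), Nat.cast_zero]

lemma coeff_Fqs_ExdSet {n : ℕ} (σ : Equiv.Perm (Fin n)) {f : Fin n → ℕ+} (hf : Antitone f) :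
    coeff (content f) (Fqs n (ExdSet σ)) = if Compatible σ f then 1 else 0 := by
  have huniq : ∀ g : Fin n → ℕ+, ((∀ j : Fin n, ∀ hj : j.val + 1 < n,
        g ⟨j.val + 1, hj⟩ ≤ g j ∧ (j.val + 1 ∈ ExdSet σ → g ⟨j.val + 1, hj⟩ < g j)) ∧
      ∀ i : ℕ+, content f i = (Finset.univ.filter fun j => g j = i).card) ↔
      g = f ∧ Compatible σ f := by
    intro g
    constructor
    · rintro ⟨h1, h2⟩
      have hg : Antitone g := antitone_of_apply_succ_le fun j hj => (h1 j hj).1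
      obtain rfl : g = f := by
        refine eq_of_antitone_of_content_eq hg hf ?_
        ext i
        rw [h2 i, content_apply]
      exact ⟨rfl, (compatible_iff σ hg).2 h1⟩
    · rintro ⟨rfl, h⟩
      refine ⟨(compatible_iff σ hf).1 h, fun i => ?_⟩
      rw [content_apply]
  rw [coeff_apply, Fqs]
  rw [Nat.card_congr (Equiv.subtypeEquivRight huniq)]
  split_ifs with h
  · simp [h]
  · simp [h]

/-- The weakly decreasing word with a given content. -/
noncomputable def sortedWord (d : ℕ+ →₀ ℕ) : Fin d.degree → ℕ+ :=
  (exists_antitone_content_eq d rfl).choose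

lemma antitone_sortedWord (d : ℕ+ →₀ ℕ) : Antitone (sortedWord d) :=
  (exists_antitone_content_eq d rfl).choose_spec.1

lemma content_sortedWord (d : ℕ+ →₀ ℕ) : content (sortedWord d) = d :=
  (exists_antitone_content_eq d rfl).choose_spec.2

/-- The generating function of the excedance polynomials of compatible permutations. -/
noncomputable def excSeries : MvPowerSeries ℕ+ (Polynomial ℚ) := fun d =>
  ∑ σ : Equiv.Perm (Fin d.degree) with Compatible σ (sortedWord d),
    Polynomial.X ^ (Finset.univ.filter fun i => i < σ i).card

lemma coeff_excSeries {d : ℕ+ →₀ ℕ} {S : Finset ℕ+} (hd : d.support ⊆ S) :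
    coeff d excSeries = coeff d (blockProd S Polynomial.X d) := by
  have h := sum_compatible_eq_coeff_blockProd (Polynomial.X : Polynomial ℚ) (S := S)
    (antitone_sortedWord d) fun j => hd (by
      rw [Finsupp.mem_support_iff]
      nth_rewrite 1 [← content_sortedWord d]
      rw [content_apply]
      exact Finset.card_ne_zero.2 ⟨j, by simp⟩)
  rw [content_sortedWord] at h
  rw [← h, coeff_apply, excSeries]

lemma coeff_Qsym (n j : ℕ) (d : ℕ+ →₀ ℕ) :
    coeff d (Qsym n j) = if d.degree = n then (coeff d excSeries).coeff j else 0 := by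
  rw [Qsym, map_sum]
  split_ifs with hd
  · subst hd
    rw [coeff_apply excSeries, excSeries, Polynomial.finsetSum_coeff, Finset.sum_filter,
      Finset.sum_filter]
    refine Finset.sum_congr rfl fun σ _ => ?_
    have h := coeff_Fqs_ExdSet σ (antitone_sortedWord d)
    rw [content_sortedWord] at h
    rw [h, Polynomial.coeff_X_pow, exc_eq_card]
    split_ifs <;> simp_all
  · exact Finset.sum_eq_zero fun σ _ => coeff_Fqs_of_degree_ne _ hd

lemma coeff_mul_congr {ι A : Type*} [CommRing A] {S : Finset ι} {φ φ' ψ ψ' : MvPowerSeries ι A}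
    {d : ι →₀ ℕ} (hd : d.support ⊆ S) (hφ : ∀ e : ι →₀ ℕ, e.support ⊆ S → coeff e φ = coeff e φ')
    (hψ : ∀ e : ι →₀ ℕ, e.support ⊆ S → coeff e ψ = coeff e ψ') :
    coeff d (φ * ψ) = coeff d (φ' * ψ') := by
  rw [coeff_mul, coeff_mul]
  refine Finset.sum_congr rfl fun p hp => ?_
  rw [Finset.HasAntidiagonal.mem_antidiagonal] at hp
  rw [hφ p.1, hψ p.2]
  · exact (Finsupp.support_mono (hp ▸ le_add_self)).trans hd
  · exact (Finsupp.support_mono (hp ▸ le_self_add)).trans hd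

/-- The complete homogeneous series `∑ t ^ n h_n`. -/
noncomputable def homSeries (r : Polynomial ℚ) : MvPowerSeries ℕ+ (Polynomial ℚ) :=
  fun d => r ^ d.degree

lemma excSeries_mul :
    excSeries * (homSeries Polynomial.X - C Polynomial.X * homSeries 1) =
      (1 - C Polynomial.X) * homSeries 1 := by
  ext1 d
  set S := d.support
  have hH : ∀ r : Polynomial ℚ, ∀ e : ℕ+ →₀ ℕ, e.support ⊆ S →
      coeff e (homSeries r) = coeff e (restrictSeries S fun d => r ^ d.degree) := fun r e he => by
    rw [coeff_restrictSeries, if_pos he]; rfl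
  have h := congrArg (coeff d) (restrictSeries_blockProd_mul S (Polynomial.X : Polynomial ℚ))
  have h1 : (fun _ : ℕ+ →₀ ℕ => (1 : Polynomial ℚ)) = fun d => 1 ^ d.degree := by simp
  rw [h1] at h
  rw [coeff_mul_congr subset_rfl (fun e he => ?_) (fun e he => ?_), h]
  · exact coeff_mul_congr subset_rfl (fun _ _ => rfl) fun e he => (hH 1 e he).symm
  · rw [coeff_restrictSeries, if_pos he, coeff_excSeries he]
  · rw [map_sub, map_sub, coeff_C_mul, coeff_C_mul, hH _ e he, hH _ e he]

/-- Record the degree in `x_1, x_2, …` by the variable `z`. -/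
noncomputable def gradedSeries (Y : MvPowerSeries ℕ+ (Polynomial ℚ)) : MvPowerSeries (Fin 2) R :=
  fun p => (fun d => if d.degree = p 1 then (coeff d Y).coeff (p 0) else 0 : R)

lemma coeff_coeff_gradedSeries (Y : MvPowerSeries ℕ+ (Polynomial ℚ)) (p : Fin 2 →₀ ℕ)
    (d : ℕ+ →₀ ℕ) : coeff d (coeff p (gradedSeries Y)) =
      if d.degree = p 1 then (coeff d Y).coeff (p 0) else 0 := rfl

lemma gradedSeries_sub (Y Z : MvPowerSeries ℕ+ (Polynomial ℚ)) :
    gradedSeries (Y - Z) = gradedSeries Y - gradedSeries Z := by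
  ext p d
  rw [map_sub, map_sub, coeff_coeff_gradedSeries, coeff_coeff_gradedSeries,
    coeff_coeff_gradedSeries, map_sub, Polynomial.coeff_sub]
  split_ifs <;> simp

lemma gradedSeries_C_X_mul (Y : MvPowerSeries ℕ+ (Polynomial ℚ)) :
    gradedSeries (C Polynomial.X * Y) = T * gradedSeries Y := by
  ext p d
  rw [T, coeff_X_mul_eq_ite, coeff_coeff_gradedSeries, coeff_C_mul]
  rcases hp : p 0 with _ | k
  · simp
  · rw [if_neg (Nat.succ_ne_zero k), coeff_coeff_gradedSeries, Polynomial.coeff_X_mul]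
    simp [hp]

lemma sum_antidiagonal_ite_mul_ite {A : Type*} [CommRing A] (u v : Polynomial A) (m k : ℕ)
    (p : Fin 2 →₀ ℕ) :
    ∑ q ∈ Finset.HasAntidiagonal.antidiagonal p, (if m = q.1 1 then u.coeff (q.1 0) else 0) *
      (if k = q.2 1 then v.coeff (q.2 0) else 0) =
      if m + k = p 1 then (u * v).coeff (p 0) else 0 := by
  split_ifs with h
  · simp only [ite_zero_mul_ite_zero]
    rw [Polynomial.coeff_mul, ← Finset.sum_filter]
    refine Finset.sum_bij' (fun q _ => (q.1 0, q.2 0))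
      (fun a _ => (Finsupp.single 0 a.1 + Finsupp.single 1 m,
        Finsupp.single 0 a.2 + Finsupp.single 1 k)) ?_ ?_ ?_ ?_ ?_
    · rintro ⟨a, b⟩ hq
      simp only [Finset.mem_filter, Finset.HasAntidiagonal.mem_antidiagonal] at hq ⊢
      rw [← hq.1, Finsupp.add_apply]
    · rintro ⟨a, b⟩ hq
      simp only [Finset.mem_filter, Finset.HasAntidiagonal.mem_antidiagonal] at hq ⊢
      refine ⟨?_, by simp, by simp⟩
      ext l
      revert l
      simp [Fin.forall_fin_two, hq, h]
    · rintro ⟨a, b⟩ hq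
      simp only [Finset.mem_filter, Finset.HasAntidiagonal.mem_antidiagonal] at hq
      refine Prod.ext ?_ ?_
      · ext l
        revert l
        simp [Fin.forall_fin_two, hq.2.1]
      · ext l
        revert l
        simp [Fin.forall_fin_two, hq.2.2]
    · rintro ⟨a, b⟩ _
      simp
    · rintro ⟨a, b⟩ _
      rfl
  · refine Finset.sum_eq_zero fun q hq => ?_
    rw [Finset.HasAntidiagonal.mem_antidiagonal] at hq
    rw [← hq, Finsupp.add_apply] at h
    rw [ite_zero_mul_ite_zero, if_neg (by omega)]

lemma gradedSeries_mul (Y Z : MvPowerSeries ℕ+ (Polynomial ℚ)) :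
    gradedSeries (Y * Z) = gradedSeries Y * gradedSeries Z := by
  ext p d
  rw [coeff_coeff_gradedSeries, coeff_mul, coeff_mul, map_sum]
  simp only [coeff_mul, coeff_coeff_gradedSeries]
  rw [Finset.sum_comm, Polynomial.finsetSum_coeff]
  simp only [sum_antidiagonal_ite_mul_ite]
  have hdeg : ∀ y ∈ Finset.HasAntidiagonal.antidiagonal d, y.1.degree + y.2.degree = d.degree := fun y hy => by
    rw [← Finset.HasAntidiagonal.mem_antidiagonal.1 hy, map_add]
  split_ifs with h
  · exact Finset.sum_congr rfl fun y hy => (if_pos ((hdeg y hy).trans h)).symm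
  · exact (Finset.sum_eq_zero fun y hy => if_neg fun h' => h ((hdeg y hy).symm.trans h')).symm

lemma genQ_eq : genQ = gradedSeries excSeries := by
  ext p d
  rw [coeff_coeff_gradedSeries, ← coeff_Qsym]
  rfl

lemma coeff_hSym (n : ℕ) (d : ℕ+ →₀ ℕ) : coeff d (hSym n) = if d.degree = n then 1 else 0 := rfl

lemma coeff_homSeries (r : Polynomial ℚ) (d : ℕ+ →₀ ℕ) :
    coeff d (homSeries r) = r ^ d.degree := rfl

lemma Hz_eq : Hz = gradedSeries (homSeries 1) := by
  ext p d
  rw [coeff_coeff_gradedSeries, coeff_homSeries, one_pow, Polynomial.coeff_one]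
  change coeff d (if p 0 = 0 then hSym (p 1) else 0) = _
  rw [apply_ite (coeff d), coeff_hSym, (coeff d).map_zero]
  split_ifs <;> rfl

lemma Hzt_eq : Hzt = gradedSeries (homSeries Polynomial.X) := by
  ext p d
  rw [coeff_coeff_gradedSeries, coeff_homSeries, Polynomial.coeff_X_pow]
  change coeff d (if p 0 = p 1 then hSym (p 1) else 0) = _
  rw [apply_ite (coeff d), coeff_hSym, (coeff d).map_zero]
  split_ifs <;> first | rfl | omega

end Permutations

theorem Q_generating_function :
    genQ * (Hzt - T * Hz) = (1 - T) * Hz := by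
  rw [genQ_eq, Hzt_eq, Hz_eq, ← gradedSeries_C_X_mul, ← gradedSeries_sub, ← gradedSeries_mul,
    excSeries_mul, sub_mul, sub_mul, one_mul, one_mul, gradedSeries_sub, gradedSeries_C_X_mul]
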